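/- The prefix-free hypothesis is necessary for the product formula: there exist languages K, L with o(K) = ω and o(L) = 1 such that o(KL) = -ω; concretely, o(a*) = ω, o({b}) = 1, but o(a*·b) = -ω when a < b. -/

import Mathlib

variable {A : Type*} [LinearOrder A]

/-- strict ordering: first difference, smaller letter -/
def ltS (u v : List A) : Prop :=
  ∃ (x y z : List A) (a b : A), a < b ∧ u = x ++ a :: y ∧ v = x ++ b :: z

/-- proper prefix ordering -/
def ltP (u v : List A) : Prop := ∃ w : List A, w ≠ [] ∧ v = u ++ w

/-- lexicographic ordering, union of ltP and ltS -/
def ltLex (u v : List A) : Prop := ltP u v ∨ ltS u v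

/-- repetition uⁿ -/
def rep (u : List A) (n : ℕ) : List A := (List.replicate n u).flatten

/-- a finite word is a prefix of an ω-word -/
def wPrefix (u : List A) (w : ℕ → A) : Prop :=
  ∀ i : Fin u.length, u.get i = w i

/-- finite word <_s ω-word -/
def ltSW (u : List A) (w : ℕ → A) : Prop :=
  ∃ i : Fin u.length, (∀ j (hj : j < i.1), u.get ⟨j, hj.trans i.2⟩ = w j) ∧ u.get i < w i

/-- ω-word <_s finite word -/
def ltWS (w : ℕ → A) (u : List A) : Prop :=
  ∃ i : Fin u.length, (∀ j (hj : j < i.1), u.get ⟨j, hj.trans i.2⟩ = w j) ∧ w i < u.get i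

/-- ω-word < ω-word -/
def ltWW (x w : ℕ → A) : Prop := ∃ i, (∀ j < i, x j = w j) ∧ x i < w i

/-- finite word <ℓ ω-word -/
def ltLexW (u : List A) (w : ℕ → A) : Prop := wPrefix u w ∨ ltSW u w

/-- `w` is the least upper bound of `S` in the lexicographic order on Σ* ∪ Σ^ω -/
def IsSupW (S : Set (List A)) (w : ℕ → A) : Prop :=
  (∀ u ∈ S, ltLexW u w) ∧
  (∀ x : ℕ → A, ltWW x w → ∃ u ∈ S, ¬ ltLexW u x) ∧
  (∀ v : List A, ltLexW v w → ∃ u ∈ S, ¬ (ltLex u v ∨ u = v))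

/-- the ω-word u v v v ⋯ -/
def uvomega [Inhabited A] (u v : List A) : ℕ → A := fun i =>
  if i < u.length then u.getD i default else v.getD ((i - u.length) % v.length) default

/-- concatenation of languages -/
def cat (K L : Set (List A)) : Set (List A) := {w | ∃ x ∈ K, ∃ y ∈ L, w = x ++ y}

/-- concatenation of a finite word and an ω-word -/
def catW (u : List A) (x : ℕ → A) : ℕ → A := fun i =>
  if h : i < u.length then u.get ⟨i, h⟩ else x (i - u.length)

/-- L has lexicographic order type ω -/
def hasTypeOmega (L : Set (List A)) : Prop :=
  Nonempty ((fun u v : L => ltLex u.1 v.1) ≃r ((· < ·) : ℕ → ℕ → Prop))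

/-- L has lexicographic order type -ω -/
def hasTypeOmegaRev (L : Set (List A)) : Prop :=
  Nonempty ((fun u v : L => ltLex u.1 v.1) ≃r (fun m n : ℕ => n < m))

def isPrefixChain (L : Set (List A)) : Prop :=
  ∀ u ∈ L, ∀ v ∈ L, u <+: v ∨ v <+: u

theorem ltLex_nil_right (u : List A) : ¬ ltLex u [] := by
  simp [ltLex, ltP, ltS]

theorem ltLex_nil_cons (b : A) (v : List A) : ltLex [] (b :: v) :=
  Or.inl ⟨b :: v, by simp, rfl⟩

theorem ltLex_cons_cons (a b : A) (u v : List A) :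
    ltLex (a :: u) (b :: v) ↔ a < b ∨ a = b ∧ ltLex u v := by
  constructor
  · rintro (⟨w, hw, h⟩ | ⟨_ | ⟨c, x⟩, y, z, a', b', hab, hu, hv⟩)
    · simp only [List.cons_append, List.cons.injEq] at h
      exact Or.inr ⟨h.1.symm, Or.inl ⟨w, hw, h.2⟩⟩
    · simp only [List.nil_append, List.cons.injEq] at hu hv
      exact Or.inl (by rwa [hu.1, hv.1])
    · simp only [List.cons_append, List.cons.injEq] at hu hv
      exact Or.inr ⟨hu.1.trans hv.1.symm, Or.inr ⟨x, y, z, a', b', hab, hu.2, hv.2⟩⟩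
  · rintro (h | ⟨rfl, ⟨w, hw, rfl⟩ | ⟨x, y, z, a', b', hab, rfl, rfl⟩⟩)
    · exact Or.inr ⟨[], u, v, a, b, h, rfl, rfl⟩
    · exact Or.inl ⟨w, hw, rfl⟩
    · exact Or.inr ⟨a :: x, y, z, a', b', hab, rfl, rfl⟩

theorem ltLex_iff_lt (u v : List A) : ltLex u v ↔ u < v := by
  induction u generalizing v with
  | nil =>
    cases v with
    | nil => simp [ltLex_nil_right]
    | cons b v => simp [ltLex_nil_cons]
  | cons a u ih =>
    cases v with
    | nil => simp [ltLex_nil_right]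
    | cons b v => rw [ltLex_cons_cons, List.cons_lt_cons_iff, ih]

theorem hasTypeOmega_range {f : ℕ → List A} (hf : StrictMono f) :
    hasTypeOmega (Set.range f) :=
  ⟨RelIso.symm
    { toEquiv := Equiv.ofInjective f hf.injective
      map_rel_iff' := by simp [ltLex_iff_lt, hf.lt_iff_lt] }⟩

theorem hasTypeOmegaRev_range {f : ℕ → List A} (hf : StrictAnti f) :
    hasTypeOmegaRev (Set.range f) :=
  ⟨RelIso.symm
    { toEquiv := Equiv.ofInjective f hf.injective
      map_rel_iff' := by simp [ltLex_iff_lt, hf.lt_iff_gt] }⟩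

theorem strictMono_replicate (a : A) : StrictMono fun k => List.replicate k a := by
  refine strictMono_nat_of_lt_succ fun n => ?_
  induction n with
  | zero => simp
  | succ n ih => exact List.cons_lt_cons_iff.2 (Or.inr ⟨rfl, ih⟩)

theorem strictAnti_replicate_append {a b : A} (h : a < b) :
    StrictAnti fun k => List.replicate k a ++ [b] := by
  refine strictAnti_nat_of_succ_lt fun n => ?_
  induction n with
  | zero => exact List.cons_lt_cons_iff.2 (Or.inl h)
  | succ n ih => exact List.cons_lt_cons_iff.2 (Or.inr ⟨rfl, ih⟩)

/-- o(a*) = ω, o({b}) = 1, but o(a*·b) = -ω (a = false < b = true). -/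
theorem stmt_19 :
    hasTypeOmega {w : List Bool | ∃ k : ℕ, w = List.replicate k false} ∧
    ({[true]} : Set (List Bool)).ncard = 1 ∧
    hasTypeOmegaRev
      (cat {w : List Bool | ∃ k : ℕ, w = List.replicate k false}
        ({[true]} : Set (List Bool))) := by
  refine ⟨?_, Set.ncard_singleton _, ?_⟩
  · convert hasTypeOmega_range (strictMono_replicate false) using 1
    ext w
    simp [eq_comm]
  · convert hasTypeOmegaRev_range (strictAnti_replicate_append Bool.false_lt_true) using 1
    ext w
    simp [cat, eq_comm]
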